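/- arXiv:1901.09916 — 3 statements merged into one kernel-verified Lean document; each statement's English description precedes it below -/
import Mathlib

section
/- Let N ≥ 1 be an integer, v > 0 and R > 0. Then (2/R²)·∫₀^R (1 − (1 + v·R²/x²)^{−N})·x dx = 1 + F(v), where F(v) = −1/(1+v)^{N−1} − N·v·( ∑_{m=1}^{N−1} 1/((1+v)^{N−m}·(N−m)) − ln(1 + 1/v) ). Equivalently, ∫₀^1 (1 − (u/(u+v))^N) du = 1 + F(v). -/
open MeasureTheory

/-- The function `F_{α_L}` of Lemma 6 of the paper. -/
noncomputable def Falpha (N : ℕ) (v : ℝ) : ℝ :=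
  -(1 / (1 + v) ^ (N - 1)) -
    N * v * ((∑ m ∈ Finset.Icc 1 (N - 1), 1 / ((1 + v) ^ (N - m) * ((N : ℝ) - m)))
      - Real.log (1 + 1 / v))

/-- Antiderivative of `1 - (u/(u+v))^(n+1)`. -/
noncomputable def antiG (n : ℕ) (v u : ℝ) : ℝ :=
  u - ((u + v) * (u / (u + v)) ^ (n + 1) - (n + 1) * v * (Real.log (u + v)
    - ∑ k ∈ Finset.range n, (u / (u + v)) ^ (k + 1) / ((k : ℝ) + 1)))

lemma antiG_deriv (n : ℕ) (v u : ℝ) (hv : 0 < v) (hu : 0 ≤ u) :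
    HasDerivAt (antiG n v) (1 - (u / (u + v)) ^ (n + 1)) u := by
  have hp : u + v ≠ 0 := by positivity
  have h1 : HasDerivAt (fun u : ℝ => u + v) 1 u := (hasDerivAt_id u).add_const v
  have hw : HasDerivAt (fun u : ℝ => u / (u + v)) (v / (u + v) ^ 2) u := by
    refine ((hasDerivAt_id u).div h1 hp).congr_deriv ?_
    simp
  have hs : HasDerivAt (fun u : ℝ => ∑ k ∈ Finset.range n, (u / (u + v)) ^ (k + 1) / ((k : ℝ) + 1))
      (∑ k ∈ Finset.range n, (u / (u + v)) ^ k * (v / (u + v) ^ 2)) u := by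
    refine HasDerivAt.fun_sum fun k _ => ?_
    refine ((hw.pow (k + 1)).div_const ((k : ℝ) + 1)).congr_deriv ?_
    have : (k : ℝ) + 1 ≠ 0 := by positivity
    push_cast
    field_simp
  have hg : (∑ k ∈ Finset.range n, (u / (u + v)) ^ k * (v / (u + v) ^ 2))
      = (1 - (u / (u + v)) ^ n) / (u + v) := by
    rw [← Finset.sum_mul]
    have h := mul_neg_geom_sum (u / (u + v)) n
    rw [← h]
    have : 1 - u / (u + v) = v / (u + v) := by field_simp; ring
    rw [this]
    field_simp
  rw [hg] at hs
  refine ((hasDerivAt_id u).sub ((h1.mul (hw.pow (n + 1))).sub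
    (((h1.log hp).sub hs).const_mul (((n : ℝ) + 1) * v)))).congr_deriv ?_
  simp only [Nat.add_sub_cancel, Pi.pow_apply]
  push_cast
  generalize hq : (u / (u + v)) ^ n = q
  rw [pow_succ, hq]
  field_simp
  ring

lemma antiG_sub (n : ℕ) (v : ℝ) (hv : 0 < v) :
    antiG n v 1 - antiG n v 0 = 1 + Falpha (n + 1) v := by
  have hp : 1 + v ≠ 0 := by positivity
  have hs : (∑ m ∈ Finset.Icc 1 n, 1 / ((1 + v) ^ (n + 1 - m) * (((n + 1 : ℕ) : ℝ) - m)))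
      = ∑ k ∈ Finset.range n, (1 / (1 + v)) ^ (k + 1) / ((k : ℝ) + 1) := by
    refine Finset.sum_bij' (fun m _ => n - m) (fun k _ => n - k) ?_ ?_ ?_ ?_ ?_
    · intro m hm; simp at hm ⊢; omega
    · intro m hm; simp at hm ⊢; omega
    · intro m hm; simp at hm ⊢; omega
    · intro m hm; simp at hm ⊢; omega
    · intro m hm
      simp only [Finset.mem_Icc] at hm
      obtain ⟨k, rfl⟩ := Nat.exists_eq_add_of_le hm.2
      have e1 : m + k + 1 - m = k + 1 := by omega
      have e2 : m + k - m = k := by omega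
      have e3 : (((m + k + 1 : ℕ) : ℝ) - m) = k + 1 := by push_cast; ring
      rw [e1, e2, e3, one_div_pow, div_div]
  have hl : Real.log (1 + 1 / v) = Real.log (1 + v) - Real.log v := by
    rw [← Real.log_div hp hv.ne']
    congr 1
    field_simp
    ring
  unfold antiG Falpha
  rw [Nat.add_sub_cancel, hs, hl]
  have h0 : (∑ k ∈ Finset.range n, ((0:ℝ) / (0 + v)) ^ (k + 1) / ((k : ℝ) + 1)) = 0 :=
    Finset.sum_eq_zero fun k _ => by simp
  rw [h0]
  have h2 : (1 + v) * (1 / (1 + v)) ^ (n + 1) = 1 / (1 + v) ^ n := by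
    rw [one_div_pow, pow_succ]; field_simp
  rw [h2]
  simp only [zero_div, zero_add, ne_eq, Nat.add_eq_zero_iff, one_ne_zero, and_false,
    not_false_eq_true, zero_pow, mul_zero]
  push_cast
  ring

/-- The closed-form evaluation underlying Lemma 6 of the paper (LOS interference integral
with path-loss exponent `α_L = 2`): `(2/R²)·∫₀^R (1 − (1 + v·R²/x²)^{−N})·x dx = 1 + F(v)`,
and equivalently `∫₀^1 (1 − (u/(u+v))^N) du = 1 + F(v)`. -/
theorem los_interference_integral_closed_form (N : ℕ) (hN : 1 ≤ N) (v : ℝ) (hv : 0 < v)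
    (R : ℝ) (hR : 0 < R) :
    (2 / R ^ 2) * ∫ x in (0:ℝ)..R, (1 - ((1 + v * R ^ 2 / x ^ 2) ^ N)⁻¹) * x
        = 1 + Falpha N v ∧
    (∫ u in (0:ℝ)..1, (1 - (u / (u + v)) ^ N)) = 1 + Falpha N v := by
  obtain ⟨n, rfl⟩ : ∃ n, N = n + 1 := ⟨N - 1, by omega⟩
  rw [← antiG_sub n v hv]
  constructor
  · have hc : (∫ x in (0:ℝ)..R, (1 - ((1 + v * R ^ 2 / x ^ 2) ^ (n + 1))⁻¹) * x)
        = ∫ x in (0:ℝ)..R, (1 - ((x ^ 2 / R ^ 2) / (x ^ 2 / R ^ 2 + v)) ^ (n + 1)) * x := by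
      congr 1
      funext x
      by_cases hx : x = 0
      · simp [hx]
      · rw [← inv_pow]
        congr 4
        have : 0 < x ^ 2 := by positivity
        field_simp
    have hI : (∫ x in (0:ℝ)..R, (1 - ((x ^ 2 / R ^ 2) / (x ^ 2 / R ^ 2 + v)) ^ (n + 1)) * x)
        = R ^ 2 / 2 * antiG n v (R ^ 2 / R ^ 2) - R ^ 2 / 2 * antiG n v (0 ^ 2 / R ^ 2) := by
      refine intervalIntegral.integral_eq_sub_of_hasDerivAt
        (f := fun x => R ^ 2 / 2 * antiG n v (x ^ 2 / R ^ 2)) ?_ ?_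
      · intro x _
        have h1 : HasDerivAt (fun x : ℝ => x ^ 2 / R ^ 2) (2 * x / R ^ 2) x := by
          simpa using (hasDerivAt_pow 2 x).div_const (R ^ 2)
        have h2 := antiG_deriv n v (x ^ 2 / R ^ 2) hv (by positivity)
        refine ((h2.comp x h1).const_mul (R ^ 2 / 2)).congr_deriv ?_
        generalize (x ^ 2 / R ^ 2 / (x ^ 2 / R ^ 2 + v)) ^ (n + 1) = q
        field_simp
      · apply Continuous.intervalIntegrable
        have : ∀ x : ℝ, x ^ 2 / R ^ 2 + v ≠ 0 := fun x => by positivity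
        fun_prop (disch := assumption)
    rw [hc, hI, div_self (by positivity), zero_pow two_ne_zero, zero_div]
    field_simp
  · refine intervalIntegral.integral_eq_sub_of_hasDerivAt ?_ ?_
    · intro u hu
      rw [Set.uIcc_of_le zero_le_one] at hu
      exact antiG_deriv n v u hv hu.1
    · apply ContinuousOn.intervalIntegrable
      intro u hu
      rw [Set.uIcc_of_le zero_le_one] at hu
      have hp : u + v ≠ 0 := by have := hu.1; positivity
      apply ContinuousAt.continuousWithinAt
      fun_prop (disch := assumption)
end

section
/- Let σ > 0, R > 0, c > 0, and let N ≥ 1, K ≥ 1, k be integers with 1 ≤ k ≤ 2K. Then ∫₀^R (1 − (1 − exp(−c·r²))^N) · f_d^k(r) dr = ((2K)! / (2·(k−1)!·(2K−k)!·σ²)) · ∑_{n=1}^{N} ∑_{w=0}^{k−1} (−1)^{n+k−w} · C(k−1,w) · C(N,n) · (1 − exp(−A(n,w)·R²)) / A(n,w), where A(n,w) = n·c + (2K−w)/(2σ²). -/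
open MeasureTheory

/-- The ordered-distance density `f_d^i` of the paper (eq. (17)) for the `i`-th nearest of
`n` points, evaluated at `r > 0`. -/
noncomputable def orderedDensity (σ : ℝ) (n i : ℕ) (r : ℝ) : ℝ :=
  ((n.factorial : ℝ) / ((i - 1).factorial * (n - i).factorial)) * (r / σ ^ 2) *
    ∑ w ∈ Finset.range i, (-1 : ℝ) ^ (i - 1 - w) * ((i - 1).choose w : ℝ) *
      Real.exp (-((n : ℝ) - w) * r ^ 2 / (2 * σ ^ 2))

theorem aux_integral (A R : ℝ) (hA : A ≠ 0) :
    ∫ r in (0:ℝ)..R, r * Real.exp (-A * r ^ 2) = (1 - Real.exp (-A * R ^ 2)) / (2 * A) := by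
  have h : ∀ x ∈ Set.uIcc (0:ℝ) R,
      HasDerivAt (fun r : ℝ => -Real.exp (-A * r ^ 2) / (2 * A)) (x * Real.exp (-A * x ^ 2)) x := by
    intro x _
    have h1 : HasDerivAt (fun r : ℝ => -A * r ^ 2) (-A * (2 * x)) x := by
      simpa using (hasDerivAt_pow 2 x).const_mul (-A)
    refine HasDerivAt.congr_deriv ((h1.exp.neg).div_const (2 * A)) ?_
    field_simp
  rw [intervalIntegral.integral_eq_sub_of_hasDerivAt h
    (Continuous.intervalIntegrable (by fun_prop) _ _)]
  simp
  ring

theorem aux_binom (x : ℝ) (N : ℕ) :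
    1 - (1 - x) ^ N = ∑ n ∈ Finset.Icc 1 N, (-1 : ℝ) ^ (n + 1) * (N.choose n : ℝ) * x ^ n := by
  have h : (1 - x) ^ N = ∑ n ∈ Finset.range (N + 1), (-x) ^ n * (N.choose n : ℝ) := by
    have := add_pow (-x) 1 N
    simp only [one_pow, mul_one] at this
    rw [← this]; ring
  rw [h, Finset.range_eq_Ico, Finset.sum_eq_sum_Ico_succ_bot (by omega)]
  have e : Finset.Ico (0 + 1) (N + 1) = Finset.Icc 1 N := by ext; simp
  rw [e]
  simp only [pow_zero, Nat.choose_zero_right, Nat.cast_one, mul_one, sub_add_cancel_left]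
  rw [← Finset.sum_neg_distrib]
  refine Finset.sum_congr rfl fun n _ => ?_
  rw [neg_pow x]; ring

/-- The exact computation behind Corollary 3 of the paper: integrating the Alzer-type
probability `1 − (1 − e^{−c r²})^N` against the `k`-th order statistic density `f_d^k`
over the LOS ball `[0, R]`. Here `A(n,w) = n·c + (2K−w)/(2σ²)`. -/
theorem near_user_coverage_closed_form
    (σ R c : ℝ) (hσ : 0 < σ) (hR : 0 < R) (hc : 0 < c)
    (N K k : ℕ) (hN : 1 ≤ N) (hK : 1 ≤ K) (hk1 : 1 ≤ k) (hk2 : k ≤ 2 * K) :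
    ∫ r in (0:ℝ)..R, (1 - (1 - Real.exp (-c * r ^ 2)) ^ N) * orderedDensity σ (2 * K) k r
      = (((2 * K).factorial : ℝ) / (2 * (k - 1).factorial * (2 * K - k).factorial * σ ^ 2)) *
          ∑ n ∈ Finset.Icc 1 N, ∑ w ∈ Finset.range k,
            (-1 : ℝ) ^ (n + k - w) * ((k - 1).choose w : ℝ) * (N.choose n : ℝ) *
              (1 - Real.exp (-(n * c + ((2 * K : ℝ) - w) / (2 * σ ^ 2)) * R ^ 2))
                / (n * c + ((2 * K : ℝ) - w) / (2 * σ ^ 2)) := by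
  have hpt : ∀ r : ℝ,
      (1 - (1 - Real.exp (-c * r ^ 2)) ^ N) * orderedDensity σ (2 * K) k r
      = ∑ n ∈ Finset.Icc 1 N, ∑ w ∈ Finset.range k,
        ((((2 * K).factorial : ℝ) / ((k - 1).factorial * (2 * K - k).factorial)) / σ ^ 2 *
          ((-1 : ℝ) ^ (n + k - w) * ((k - 1).choose w : ℝ) * (N.choose n : ℝ))) *
          (r * Real.exp (-(n * c + ((2 * K : ℝ) - w) / (2 * σ ^ 2)) * r ^ 2)) := by
    intro r
    rw [aux_binom, orderedDensity, Finset.sum_mul]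
    refine Finset.sum_congr rfl fun n _ => ?_
    rw [Finset.mul_sum, Finset.mul_sum]
    refine Finset.sum_congr rfl fun w hw => ?_
    have hw' := Finset.mem_range.mp hw
    have e1 : (-1 : ℝ) ^ (n + k - w) = (-1) ^ (n + 1) * (-1) ^ (k - 1 - w) := by
      rw [← pow_add]; congr 1; omega
    have e2 : Real.exp (-(n * c + ((2 * K : ℝ) - w) / (2 * σ ^ 2)) * r ^ 2)
        = Real.exp (-c * r ^ 2) ^ n *
          Real.exp (-(((2 * K : ℕ) : ℝ) - w) * r ^ 2 / (2 * σ ^ 2)) := by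
      rw [← Real.exp_nat_mul, ← Real.exp_add]
      congr 1
      push_cast
      ring
    rw [e1, e2]
    ring
  simp_rw [hpt]
  rw [intervalIntegral.integral_finsetSum
    (fun n _ => Continuous.intervalIntegrable (by fun_prop) _ _), Finset.mul_sum]
  refine Finset.sum_congr rfl fun n hn => ?_
  rw [intervalIntegral.integral_finsetSum
    (fun w _ => Continuous.intervalIntegrable (by fun_prop) _ _), Finset.mul_sum]
  refine Finset.sum_congr rfl fun w hw => ?_
  have hA : 0 < n * c + ((2 * K : ℝ) - w) / (2 * σ ^ 2) := by
    have hw' := Finset.mem_range.mp hw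
    have h1 : (w : ℝ) ≤ 2 * K := by exact_mod_cast (by omega : w ≤ 2 * K)
    have h2 : (1 : ℝ) ≤ n := by exact_mod_cast (Finset.mem_Icc.mp hn).1
    have h3 : 0 ≤ ((2 * K : ℝ) - w) / (2 * σ ^ 2) := div_nonneg (by linarith) (by positivity)
    have h4 : 0 < n * c := by positivity
    linarith
  rw [intervalIntegral.integral_const_mul, aux_integral _ _ hA.ne']
  generalize (n * c + ((2 * K : ℝ) - w) / (2 * σ ^ 2)) = A at *
  field_simp
end

section
/- Let σ > 0, R > 0, c > 0 and let K ≥ 1 be an integer. Set Q = c + 1/(2σ²) and χ = (2K−1)/(2σ²). Then ∫₀^R ( ∫_r^R exp(−c·t²) · (t/σ²) · exp((r² − t²)/(2σ²)) dt ) · (2K·r/σ²) · exp(−2K·r²/(2σ²)) dr = (K/(2σ⁴·Q)) · ( 1/(Q+χ) + Q·exp(−(Q+χ)·R²)/((Q+χ)·χ) − exp(−Q·R²)/χ ). -/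
open MeasureTheory

theorem aux_gauss (q a b : ℝ) (hq : q ≠ 0) :
    (∫ t in a..b, t * Real.exp (-q * t ^ 2))
      = (Real.exp (-q * a ^ 2) - Real.exp (-q * b ^ 2)) / (2 * q) := by
  have h : ∀ t ∈ Set.uIcc a b,
      HasDerivAt (fun t : ℝ => -Real.exp (-q * t ^ 2) / (2 * q)) (t * Real.exp (-q * t ^ 2)) t := by
    intro t _
    have h1 : HasDerivAt (fun t : ℝ => -q * t ^ 2) (-q * (2 * t)) t := by
      simpa using (hasDerivAt_pow 2 t).const_mul (-q)
    refine (h1.exp.neg.div_const (2 * q)).congr_deriv ?_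
    field_simp
  rw [intervalIntegral.integral_eq_sub_of_hasDerivAt h
    (Continuous.intervalIntegrable (by fun_prop) _ _)]
  ring

/-- The exact double-integral evaluation behind Corollary 5 of the paper: with
`Q = c + 1/(2σ²)` and `χ = (2K−1)/(2σ²)`,
`∫₀^R (∫_r^R e^{−c t²}·(t/σ²)·e^{(r²−t²)/(2σ²)} dt)·(2K·r/σ²)·e^{−2K·r²/(2σ²)} dr`
equals `(K/(2σ⁴·Q))·(1/(Q+χ) + Q·e^{−(Q+χ)R²}/((Q+χ)·χ) − e^{−Q·R²}/χ)`. -/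
theorem far_user_coverage_closed_form
    (σ R c : ℝ) (hσ : 0 < σ) (hR : 0 < R) (hc : 0 < c) (K : ℕ) (hK : 1 ≤ K) :
    (∫ r in (0:ℝ)..R,
        (∫ t in r..R,
            Real.exp (-c * t ^ 2) * (t / σ ^ 2) * Real.exp ((r ^ 2 - t ^ 2) / (2 * σ ^ 2))) *
          ((2 * K * r / σ ^ 2) * Real.exp (-(2 * K) * r ^ 2 / (2 * σ ^ 2))))
      = ((K : ℝ) / (2 * σ ^ 4 * (c + 1 / (2 * σ ^ 2)))) *
          (1 / ((c + 1 / (2 * σ ^ 2)) + ((2 * K : ℝ) - 1) / (2 * σ ^ 2))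
            + (c + 1 / (2 * σ ^ 2)) *
                Real.exp (-((c + 1 / (2 * σ ^ 2)) + ((2 * K : ℝ) - 1) / (2 * σ ^ 2)) * R ^ 2)
                / (((c + 1 / (2 * σ ^ 2)) + ((2 * K : ℝ) - 1) / (2 * σ ^ 2))
                    * (((2 * K : ℝ) - 1) / (2 * σ ^ 2)))
            - Real.exp (-(c + 1 / (2 * σ ^ 2)) * R ^ 2) / (((2 * K : ℝ) - 1) / (2 * σ ^ 2))) := by
  have hK' : (1 : ℝ) ≤ K := by exact_mod_cast hK
  have hs : σ ≠ 0 := hσ.ne'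
  obtain ⟨Q, hQ⟩ : ∃ Q, Q = c + 1 / (2 * σ ^ 2) := ⟨_, rfl⟩
  obtain ⟨χ, hχ⟩ : ∃ χ, χ = ((2 * K : ℝ) - 1) / (2 * σ ^ 2) := ⟨_, rfl⟩
  have hQ0 : 0 < Q := by rw [hQ]; positivity
  have hχ0 : 0 < χ := by
    rw [hχ]; apply div_pos
    · linarith
    · positivity
  rw [← hQ, ← hχ]
  have inner : ∀ r : ℝ, (∫ t in r..R,
      Real.exp (-c * t ^ 2) * (t / σ ^ 2) * Real.exp ((r ^ 2 - t ^ 2) / (2 * σ ^ 2)))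
      = Real.exp (r ^ 2 / (2 * σ ^ 2)) / σ ^ 2 *
        ((Real.exp (-Q * r ^ 2) - Real.exp (-Q * R ^ 2)) / (2 * Q)) := by
    intro r
    rw [← aux_gauss Q r R hQ0.ne', ← intervalIntegral.integral_const_mul]
    congr 1
    funext t
    have e : Real.exp (-c * t ^ 2) * Real.exp ((r ^ 2 - t ^ 2) / (2 * σ ^ 2))
        = Real.exp (r ^ 2 / (2 * σ ^ 2)) * Real.exp (-Q * t ^ 2) := by
      rw [← Real.exp_add, ← Real.exp_add, hQ]
      congr 1
      ring
    linear_combination (t / σ ^ 2) * e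
  have outer : ∀ r : ℝ, (∫ t in r..R,
      Real.exp (-c * t ^ 2) * (t / σ ^ 2) * Real.exp ((r ^ 2 - t ^ 2) / (2 * σ ^ 2))) *
          ((2 * K * r / σ ^ 2) * Real.exp (-(2 * K) * r ^ 2 / (2 * σ ^ 2)))
      = K / (σ ^ 4 * Q) * (r * Real.exp (-(Q + χ) * r ^ 2))
        - K / (σ ^ 4 * Q) * Real.exp (-Q * R ^ 2) * (r * Real.exp (-χ * r ^ 2)) := by
    intro r
    rw [inner]
    have e1 : Real.exp (r ^ 2 / (2 * σ ^ 2)) * Real.exp (-(2 * K) * r ^ 2 / (2 * σ ^ 2))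
        = Real.exp (-χ * r ^ 2) := by
      rw [← Real.exp_add, hχ]
      congr 1
      ring
    have e2 : Real.exp (-(Q + χ) * r ^ 2) = Real.exp (-Q * r ^ 2) * Real.exp (-χ * r ^ 2) := by
      rw [← Real.exp_add]
      congr 1
      ring
    rw [e2, ← e1]
    field_simp
  simp_rw [outer]
  have hS : Q + χ ≠ 0 := by positivity
  rw [intervalIntegral.integral_sub (Continuous.intervalIntegrable (by fun_prop) _ _)
    (Continuous.intervalIntegrable (by fun_prop) _ _),
    intervalIntegral.integral_const_mul, intervalIntegral.integral_const_mul,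
    aux_gauss _ _ _ hS, aux_gauss _ _ _ hχ0.ne']
  have e2 : Real.exp (-(Q + χ) * R ^ 2) = Real.exp (-Q * R ^ 2) * Real.exp (-χ * R ^ 2) := by
    rw [← Real.exp_add]
    congr 1
    ring
  rw [e2]
  generalize Real.exp (-Q * R ^ 2) = A
  generalize Real.exp (-χ * R ^ 2) = B
  have e0 : ∀ x : ℝ, Real.exp (x * 0 ^ 2) = 1 := by intro x; simp
  rw [e0, e0]
  field_simp
  ring
end
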